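/- An element η ∈ V* is a Bethe root (i.e. λ = iη is a purely imaginary solution of the Bethe ansatz equations) if and only if η is a critical point of the master function S_k(μ,·) for some weight μ ∈ P, equivalently, if and only if η + σ_η^k = 2πμ for some μ ∈ P. -/

import Mathlib

open scoped BigOperators
open RealInnerProductSpace

noncomputable section

/-- The coroot `α∨` of a root `α`, under the identification of `V*` with `V`
via the inner product: `ξ(α∨) = 2⟨ξ,α⟩/‖α‖²`. -/
def coroot {V : Type*} [NormedAddCommGroup V] [InnerProductSpace ℝ V] (α : V) : V :=
  (2 / ‖α‖ ^ 2) • α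

/-- The orthogonal reflection `s_α` in the hyperplane orthogonal to `α`:
`s_α(ξ) = ξ − ξ(α∨)·α = ξ − α(ξ)·α∨`. -/
def sRefl {V : Type*} [NormedAddCommGroup V] [InnerProductSpace ℝ V] (α v : V) : V :=
  v - ⟪α, v⟫ • coroot α

/-- A finite, irreducible, reduced, crystallographic root system `Σ₀` in the dual of
the Euclidean space `V` (identified with `V` via the inner product), together with a
fixed base of simple roots, the positive roots, and the highest root. -/
structure RootSystemBase (V : Type*) [NormedAddCommGroup V] [InnerProductSpace ℝ V]
    [FiniteDimensional ℝ V] where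
  roots : Finset V
  roots_nonempty : roots.Nonempty
  ne_zero : ∀ α ∈ roots, α ≠ (0 : V)
  /-- reduced -/
  reduced : ∀ α ∈ roots, ∀ c : ℝ, c • α ∈ roots → c = 1 ∨ c = -1
  /-- crystallographic: `β(α∨) ∈ ℤ` -/
  crystallographic : ∀ α ∈ roots, ∀ β ∈ roots, ∃ m : ℤ, ⟪β, coroot α⟫ = (m : ℝ)
  /-- stable under the reflections `s_α` -/
  refl_mem : ∀ α ∈ roots, ∀ β ∈ roots, sRefl α β ∈ roots
  /-- `Σ₀` spans `V*` -/
  spanning : Submodule.span ℝ (roots : Set V) = ⊤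
  /-- irreducible: no nontrivial orthogonal decomposition -/
  irreducible : ∀ s : Finset V, s ⊆ roots →
    (∀ α ∈ s, ∀ β ∈ roots, β ∉ s → ⟪α, β⟫ = 0) → s = ∅ ∨ s = roots
  /-- the fixed base of simple roots -/
  simples : Finset V
  simples_sub : simples ⊆ roots
  simples_indep : LinearIndependent ℝ (fun β : {x // x ∈ simples} => (β : V))
  /-- the positive roots w.r.t. the base -/
  pos : Finset V
  pos_sub : pos ⊆ roots
  simples_sub_pos : simples ⊆ pos
  pos_or_neg : ∀ α ∈ roots, (α ∈ pos ∧ -α ∉ pos) ∨ (α ∉ pos ∧ -α ∈ pos)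
  pos_combo : ∀ α ∈ pos, ∃ c : V → ℝ, (∀ β, 0 ≤ c β) ∧ α = ∑ β ∈ simples, c β • β
  /-- the highest root `φ` -/
  hroot : V
  hroot_pos : hroot ∈ pos
  hroot_highest : ∀ α ∈ roots, ∃ c : V → ℝ, (∀ β, 0 ≤ c β) ∧
    hroot - α = ∑ β ∈ simples, c β • β

variable {V : Type*} [NormedAddCommGroup V] [InnerProductSpace ℝ V] [FiniteDimensional ℝ V]

/-- The Weyl group `W₀`: the subgroup of linear automorphisms of `V` generated by the
orthogonal reflections in the roots. -/
def weylGroup (R : RootSystemBase V) : Subgroup (V ≃ₗ[ℝ] V) :=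
  Subgroup.closure {w : V ≃ₗ[ℝ] V | ∃ α ∈ R.roots, ∀ v, w v = sRefl α v}

/-- A strictly positive `W₀`-invariant multiplicity function. -/
def IsMultiplicity (R : RootSystemBase V) (k : V → ℝ) : Prop :=
  (∀ α ∈ R.roots, 0 < k α) ∧
  (∀ w : V ≃ₗ[ℝ] V, w ∈ weylGroup R → ∀ α ∈ R.roots, k (w α) = k α)

/-- `σ_η^k = Σ_{α∈Σ₀} arctan(η(α∨)/k_α)·α`. -/
def sigmaFun (R : RootSystemBase V) (k : V → ℝ) (η : V) : V :=
  ∑ α ∈ R.roots, Real.arctan (⟪η, coroot α⟫ / k α) • α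

/-- The master function
`S_k(μ,ξ) = ½‖ξ‖² − 2π⟨μ,ξ⟩ + ½ Σ_{α∈Σ₀} ‖α‖² ∫₀^{ξ(α∨)} arctan(t/k_α) dt`. -/
def masterFun (R : RootSystemBase V) (k : V → ℝ) (μ ξ : V) : ℝ :=
  ‖ξ‖ ^ 2 / 2 - 2 * Real.pi * ⟪μ, ξ⟫ +
    (1 / 2) * ∑ α ∈ R.roots, ‖α‖ ^ 2 * ∫ t in (0:ℝ)..(⟪ξ, coroot α⟫), Real.arctan (t / k α)

/-- Membership in the weight lattice `P = {λ ∈ V* : λ(α∨) ∈ ℤ ∀α ∈ Σ₀}`. -/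
def IsWeight (R : RootSystemBase V) (lam : V) : Prop :=
  ∀ α ∈ R.roots, ∃ m : ℤ, ⟪lam, coroot α⟫ = (m : ℝ)

/-- `η ∈ V*` is a Bethe root: `λ = iη` solves the Bethe ansatz equations
`e^{(wλ)(φ∨)} = ∏_{α∈Σ₀⁺} ((wλ)(α∨) − k_α)/((wλ)(α∨) + k_α))^{α(φ∨)}` for all `w ∈ W₀`,
where `m α = α(φ∨) ∈ ℤ≥0`. -/
def IsBetheRoot (R : RootSystemBase V) (k : V → ℝ) (m : V → ℕ) (η : V) : Prop :=
  ∀ w : V ≃ₗ[ℝ] V, w ∈ weylGroup R →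
    Complex.exp (Complex.I * (⟪w η, coroot R.hroot⟫ : ℝ)) =
      ∏ α ∈ R.pos,
        ((Complex.I * (⟪w η, coroot α⟫ : ℝ) - (k α : ℂ)) /
         (Complex.I * (⟪w η, coroot α⟫ : ℝ) + (k α : ℂ))) ^ (m α)

end

noncomputable section

section Reflections

variable {V : Type*} [NormedAddCommGroup V] [InnerProductSpace ℝ V]

lemma coroot_neg (α : V) : coroot (-α) = -coroot α := by
  simp [coroot]

lemma inner_coroot (x α : V) : ⟪x, coroot α⟫ = 2 / ‖α‖ ^ 2 * ⟪x, α⟫ := by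
  rw [coroot, real_inner_smul_right]

lemma sRefl_eq (α v : V) : sRefl α v = v - ⟪v, coroot α⟫ • α := by
  rw [sRefl, inner_coroot, coroot, smul_smul, real_inner_comm, mul_comm]

lemma inner_coroot_self {α : V} (hα : α ≠ 0) : ⟪α, coroot α⟫ = 2 := by
  have : ‖α‖ ≠ 0 := norm_ne_zero_iff.2 hα
  rw [inner_coroot, real_inner_self_eq_norm_sq]
  field_simp

lemma sRefl_self {α : V} (hα : α ≠ 0) : sRefl α α = -α := by
  rw [sRefl_eq, inner_coroot_self hα, two_smul]
  abel

lemma sRefl_sRefl {α : V} (hα : α ≠ 0) (v : V) : sRefl α (sRefl α v) = v := by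
  rw [sRefl_eq α (sRefl α v), sRefl_eq α v, inner_sub_left, real_inner_smul_left,
    inner_coroot_self hα]
  module

lemma inner_sRefl_sRefl {α : V} (hα : α ≠ 0) (x y : V) :
    ⟪sRefl α x, sRefl α y⟫ = ⟪x, y⟫ := by
  have : ‖α‖ ≠ 0 := norm_ne_zero_iff.2 hα
  simp only [sRefl_eq, inner_coroot, inner_sub_left, inner_sub_right, real_inner_smul_left,
    real_inner_smul_right, real_inner_self_eq_norm_sq, real_inner_comm α]
  field_simp
  ring

/-- The reflection `s_α` as a linear automorphism. -/
def reflEquiv (α : V) (hα : α ≠ 0) : V ≃ₗ[ℝ] V :=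
  LinearEquiv.ofInvolutive
    { toFun := sRefl α
      map_add' := fun x y => by simp only [sRefl_eq, inner_add_left]; module
      map_smul' := fun c x => by
        simp only [sRefl_eq, real_inner_smul_left, RingHom.id_apply]; module }
    (sRefl_sRefl hα)

lemma reflEquiv_apply (α : V) (hα : α ≠ 0) (v : V) : reflEquiv α hα v = sRefl α v := rfl

end Reflections

namespace RootSystemBase

variable {V : Type*} [NormedAddCommGroup V] [InnerProductSpace ℝ V] [FiniteDimensional ℝ V]
  (R : RootSystemBase V)

lemma reflEquiv_mem_weylGroup {α : V} (hα : α ∈ R.roots) :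
    reflEquiv α (R.ne_zero α hα) ∈ weylGroup R :=
  Subgroup.subset_closure ⟨α, hα, fun _ => rfl⟩

lemma weylGroup_inner_and_mem {w : V ≃ₗ[ℝ] V} (hw : w ∈ weylGroup R) :
    (∀ x y, ⟪w x, w y⟫ = ⟪x, y⟫) ∧ ∀ α, w α ∈ R.roots ↔ α ∈ R.roots := by
  induction hw using Subgroup.closure_induction with
  | mem w h =>
    obtain ⟨α, hα, h⟩ := h
    have h0 := R.ne_zero α hα
    refine ⟨fun x y => by rw [h, h, inner_sRefl_sRefl h0], fun β => ⟨fun hβ => ?_, fun hβ => ?_⟩⟩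
    · rw [h] at hβ
      simpa [sRefl_sRefl h0] using R.refl_mem α hα _ hβ
    · rw [h]
      exact R.refl_mem α hα β hβ
  | one => simp
  | mul u v _ _ hu hv =>
    exact ⟨fun x y => by rw [LinearEquiv.mul_apply, LinearEquiv.mul_apply, hu.1, hv.1],
      fun α => by rw [LinearEquiv.mul_apply, hu.2, hv.2]⟩
  | inv u _ hu =>
    have key : ∀ x, u (u⁻¹ x) = x := fun x => u.apply_symm_apply x
    exact ⟨fun x y => by rw [← hu.1, key, key], fun α => by rw [← hu.2, key]⟩

variable {R}

lemma inner_weyl {w : V ≃ₗ[ℝ] V} (hw : w ∈ weylGroup R) (x y : V) : ⟪w x, w y⟫ = ⟪x, y⟫ :=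
  (R.weylGroup_inner_and_mem hw).1 x y

lemma weyl_mem_roots_iff {w : V ≃ₗ[ℝ] V} (hw : w ∈ weylGroup R) {α : V} :
    w α ∈ R.roots ↔ α ∈ R.roots :=
  (R.weylGroup_inner_and_mem hw).2 α

lemma norm_weyl {w : V ≃ₗ[ℝ] V} (hw : w ∈ weylGroup R) (x : V) : ‖w x‖ = ‖x‖ := by
  rw [norm_eq_sqrt_real_inner, inner_weyl hw, ← norm_eq_sqrt_real_inner]

lemma coroot_weyl {w : V ≃ₗ[ℝ] V} (hw : w ∈ weylGroup R) (α : V) :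
    coroot (w α) = w (coroot α) := by
  rw [coroot, norm_weyl hw, coroot, map_smul]

lemma neg_mem_roots {α : V} (hα : α ∈ R.roots) : -α ∈ R.roots := by
  simpa [sRefl_self (R.ne_zero α hα)] using R.refl_mem α hα α hα

lemma multiplicity_neg {k : V → ℝ} (hk : IsMultiplicity R k) {α : V} (hα : α ∈ R.roots) :
    k (-α) = k α := by
  simpa [reflEquiv_apply, sRefl_self (R.ne_zero α hα)] using
    hk.2 _ (R.reflEquiv_mem_weylGroup hα) α hα

lemma hroot_mem : R.hroot ∈ R.roots := R.pos_sub R.hroot_pos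

lemma sigmaFun_weyl {k : V → ℝ} (hk : IsMultiplicity R k) {w : V ≃ₗ[ℝ] V}
    (hw : w ∈ weylGroup R) (η : V) : sigmaFun R k (w η) = w (sigmaFun R k η) := by
  rw [sigmaFun, sigmaFun, map_sum]
  symm
  refine Finset.sum_bij (fun α _ => w α) (fun α hα => (weyl_mem_roots_iff hw).2 hα)
    (fun _ _ _ _ h => w.injective h) (fun β hβ => ⟨w.symm β, ?_, w.apply_symm_apply β⟩)
    (fun α hα => ?_)
  · rw [← weyl_mem_roots_iff hw, w.apply_symm_apply]
    exact hβ
  · rw [coroot_weyl hw, inner_weyl hw, hk.2 w hw α hα, map_smul]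

lemma sum_roots_eq_two_mul_sum_pos (f : V → ℝ) (hf : ∀ α ∈ R.roots, f (-α) = f α) :
    ∑ α ∈ R.roots, f α = 2 * ∑ α ∈ R.pos, f α := by
  classical
  have hsub : ∑ α ∈ R.roots \ R.pos, f α = ∑ α ∈ R.pos, f α := by
    symm
    refine Finset.sum_bij (fun α _ => -α) (fun α hα => ?_) (fun _ _ _ _ h => neg_injective h)
      (fun β hβ => ⟨-β, ?_, neg_neg β⟩) (fun α hα => (hf α (R.pos_sub hα)).symm)
    · have h := R.pos_or_neg α (R.pos_sub hα)
      exact Finset.mem_sdiff.2 ⟨neg_mem_roots (R.pos_sub hα), by tauto⟩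
    · rw [Finset.mem_sdiff] at hβ
      have h := R.pos_or_neg β hβ.1
      tauto
  rw [← Finset.sum_sdiff R.pos_sub, hsub, two_mul]

variable (R) in
/-- Some linear functional takes the value `1` on every simple root. -/
lemma exists_height : ∃ h : V →ₗ[ℝ] ℝ, ∀ β ∈ R.simples, h β = 1 := by
  obtain ⟨g, hg⟩ := LinearMap.exists_leftInverse_of_injective _
    (LinearMap.ker_eq_bot.2 R.simples_indep)
  refine ⟨Finsupp.linearCombination ℝ (fun _ => (1 : ℝ)) ∘ₗ g, fun β hβ => ?_⟩
  have h := LinearMap.congr_fun hg (Finsupp.single ⟨β, hβ⟩ 1)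
  rw [LinearMap.comp_apply, Finsupp.linearCombination_single, one_smul, LinearMap.id_apply] at h
  rw [LinearMap.comp_apply, h, Finsupp.linearCombination_single, one_smul]

/-- The negative of a positive root is not a nonnegative combination of simple roots. -/
lemma not_pos_of_neg_combo {α : V} (hα : α ∈ R.pos) {c : V → ℝ} (hc : ∀ β, 0 ≤ c β)
    (h : -α = ∑ β ∈ R.simples, c β • β) : False := by
  obtain ⟨ht, h1⟩ := R.exists_height
  obtain ⟨d, hd, hαd⟩ := R.pos_combo α hα
  have hsum : ∀ e : V → ℝ, ht (∑ β ∈ R.simples, e β • β) = ∑ β ∈ R.simples, e β := fun e => by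
    rw [map_sum]
    exact Finset.sum_congr rfl fun β hβ => by rw [map_smul, h1 β hβ, smul_eq_mul, mul_one]
  have h2 : ht α = ∑ β ∈ R.simples, d β := by rw [← hsum, ← hαd]
  have h3 : ht (-α) = ∑ β ∈ R.simples, c β := by rw [← hsum, ← h]
  rw [map_neg] at h3
  have h4 : 0 ≤ ∑ β ∈ R.simples, c β := Finset.sum_nonneg fun β _ => hc β
  have h5 : ∑ β ∈ R.simples, d β = 0 :=
    le_antisymm (by linarith) (Finset.sum_nonneg fun β _ => hd β)
  rw [Finset.sum_eq_zero_iff_of_nonneg fun β _ => hd β] at h5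
  refine R.ne_zero α (R.pos_sub hα) ?_
  rw [hαd]
  exact Finset.sum_eq_zero fun β hβ => by rw [h5 β hβ, zero_smul]

lemma mem_pos_of_combo {α : V} (hα : α ∈ R.roots) {c : V → ℝ} (hc : ∀ β, 0 ≤ c β)
    (h : α = ∑ β ∈ R.simples, c β • β) : α ∈ R.pos := by
  rcases R.pos_or_neg α hα with h' | h'
  · exact h'.1
  · exact (not_pos_of_neg_combo h'.2 hc (by rw [neg_neg]; exact h)).elim

lemma inner_hroot_nonneg {m : V → ℕ} (hm : ∀ α ∈ R.pos, ⟪α, coroot R.hroot⟫ = (m α : ℝ))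
    {α : V} (hα : α ∈ R.pos) : 0 ≤ ⟪α, R.hroot⟫ := by
  have h := hm α hα
  have h0 : 0 < ‖R.hroot‖ := norm_pos_iff.2 (R.ne_zero _ hroot_mem)
  rw [inner_coroot] at h
  by_contra! hlt
  have : 2 / ‖R.hroot‖ ^ 2 * ⟪α, R.hroot⟫ < 0 := mul_neg_of_pos_of_neg (by positivity) hlt
  have : (0 : ℝ) ≤ m α := by positivity
  linarith

/-- The highest root is a longest root. -/
lemma norm_le_norm_hroot {m : V → ℕ} (hm : ∀ α ∈ R.pos, ⟪α, coroot R.hroot⟫ = (m α : ℝ))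
    {γ : V} (hγ : γ ∈ R.roots) : ‖γ‖ ≤ ‖R.hroot‖ := by
  classical
  obtain ⟨ht, h1⟩ := R.exists_height
  obtain ⟨δ, hδ, hδmax⟩ := R.roots.exists_max_image (fun α => ‖α‖) R.roots_nonempty
  obtain ⟨α, hα, hαmax⟩ := (R.roots.filter fun α => ‖α‖ = ‖δ‖).exists_max_image ht
    ⟨δ, Finset.mem_filter.2 ⟨hδ, rfl⟩⟩
  rw [Finset.mem_filter] at hα
  have hdom : ∀ β ∈ R.simples, 0 ≤ ⟪β, α⟫ := by
    intro β hβ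
    have hβr := R.simples_sub hβ
    have h0 : 0 < ‖β‖ := norm_pos_iff.2 (R.ne_zero β hβr)
    have hle := hαmax (sRefl β α) (Finset.mem_filter.2 ⟨R.refl_mem β hβr α hα.1, by
      rw [← hα.2, ← reflEquiv_apply β (R.ne_zero β hβr),
        norm_weyl (R.reflEquiv_mem_weylGroup hβr)]⟩)
    rw [sRefl_eq, map_sub, map_smul, h1 β hβ, smul_eq_mul, mul_one, inner_coroot] at hle
    rw [real_inner_comm]
    have : 0 ≤ 2 / ‖β‖ ^ 2 * ⟪α, β⟫ := by linarith
    exact nonneg_of_mul_nonneg_right this (by positivity)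
  obtain ⟨c, hc, hcs⟩ := R.hroot_highest α hα.1
  have key : 0 ≤ ⟪R.hroot - α, R.hroot + α⟫ := by
    rw [hcs, sum_inner]
    refine Finset.sum_nonneg fun β hβ => ?_
    rw [real_inner_smul_left, inner_add_right]
    exact mul_nonneg (hc β)
      (add_nonneg (inner_hroot_nonneg hm (R.simples_sub_pos hβ)) (hdom β hβ))
  rw [inner_sub_left, inner_add_right, inner_add_right, real_inner_comm α R.hroot,
    real_inner_self_eq_norm_sq, real_inner_self_eq_norm_sq] at key
  have : ‖α‖ ≤ ‖R.hroot‖ := by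
    refine le_of_sq_le_sq ?_ (norm_nonneg _)
    linarith
  exact (hδmax γ hγ).trans (hα.2 ▸ this)

/-- Pairing a root `α` with a coroot of a longest root `β ≠ ±α` gives `0` or `±1`. -/
lemma abs_inner_coroot_lt_two {α β : V} (hα : α ∈ R.roots) (hβ : β ∈ R.roots)
    (hle : ‖α‖ ≤ ‖β‖) (h1 : α ≠ β) (h2 : α ≠ -β) : |⟪α, coroot β⟫| < 2 := by
  have hα0 := R.ne_zero α hα
  have hβ0 := R.ne_zero β hβ
  have hb : 0 < ‖β‖ := norm_pos_iff.2 hβ0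
  have hlt : |⟪α, β⟫| < ‖α‖ * ‖β‖ := by
    refine lt_of_le_of_ne (abs_real_inner_le_norm α β) fun h => ?_
    have h3 : |⟪β, α⟫ / (‖β‖ * ‖α‖)| = 1 := by
      rw [abs_div, real_inner_comm, h, abs_of_nonneg (by positivity : 0 ≤ ‖β‖ * ‖α‖), mul_comm]
      exact div_self (mul_ne_zero hb.ne' (norm_ne_zero_iff.2 hα0))
    obtain ⟨-, r, -, hr⟩ := (abs_real_inner_div_norm_mul_norm_eq_one_iff β α).1 h3
    rcases R.reduced β hβ r (hr ▸ hα) with rfl | rfl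
    · exact h1 (by simpa using hr)
    · exact h2 (by simpa using hr)
  rw [inner_coroot, abs_mul, abs_of_pos (by positivity), div_mul_eq_mul_div,
    div_lt_iff₀ (by positivity)]
  nlinarith

/-- Every root is nonorthogonal to some element of the Weyl orbit of the highest root. -/
lemma exists_inner_weyl_hroot_ne_zero {α : V} (hα : α ∈ R.roots) :
    ∃ w ∈ weylGroup R, ⟪α, w R.hroot⟫ ≠ 0 := by
  classical
  by_contra! hcon
  let U : Submodule ℝ V := Submodule.span ℝ {x | ∃ w ∈ weylGroup R, x = w R.hroot}
  have horth : ∀ β ∈ R.roots, β ∉ U → ∀ x ∈ U, ⟪x, β⟫ = 0 := by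
    intro β hβ hβU x hx
    induction hx using Submodule.span_induction with
    | mem x h =>
      obtain ⟨w, hw, rfl⟩ := h
      by_contra hne
      have hmem : sRefl β (w R.hroot) ∈ U := Submodule.subset_span
        ⟨reflEquiv β (R.ne_zero β hβ) * w, mul_mem (R.reflEquiv_mem_weylGroup hβ) hw, rfl⟩
      have hwU : w R.hroot ∈ U := Submodule.subset_span ⟨w, hw, rfl⟩
      rw [sRefl_eq, Submodule.sub_mem_iff_right _ hwU] at hmem
      refine hβU ((Submodule.smul_mem_iff _ ?_).1 hmem)
      have : ‖β‖ ≠ 0 := norm_ne_zero_iff.2 (R.ne_zero β hβ)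
      rw [inner_coroot]
      positivity
    | zero => simp
    | add x y _ _ hx hy => rw [inner_add_left, hx, hy, add_zero]
    | smul c x _ hx => rw [real_inner_smul_left, hx, mul_zero]
  have hφU : R.hroot ∈ U := Submodule.subset_span ⟨1, one_mem _, rfl⟩
  have hall : R.roots.filter (· ∈ U) = R.roots := by
    refine (R.irreducible _ (Finset.filter_subset _ _) ?_).resolve_left
      (Finset.ne_empty_of_mem (Finset.mem_filter.2 ⟨hroot_mem, hφU⟩))
    intro x hx β hβ hβs
    rw [Finset.mem_filter] at hx hβs
    exact horth β hβ (fun h => hβs ⟨hβ, h⟩) x hx.2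
  have hαU : α ∈ U := (Finset.mem_filter.1 (hall.symm ▸ hα)).2
  have hperp : ∀ x ∈ U, ⟪α, x⟫ = 0 := by
    intro x hx
    induction hx using Submodule.span_induction with
    | mem x h =>
      obtain ⟨w, hw, rfl⟩ := h
      exact hcon w hw
    | zero => simp
    | add x y _ _ hx hy => rw [inner_add_right, hx, hy, add_zero]
    | smul c x _ hx => rw [real_inner_smul_right, hx, mul_zero]
  exact R.ne_zero α hα (inner_self_eq_zero.1 (hperp α hαU))

/-- The Weyl orbit of the coroot of the highest root generates the coroot lattice. -/
lemma coroot_mem_of_weyl_coroot_hroot_mem {m : V → ℕ}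
    (hm : ∀ α ∈ R.pos, ⟪α, coroot R.hroot⟫ = (m α : ℝ)) (L : AddSubgroup V)
    (hL : ∀ w ∈ weylGroup R, w (coroot R.hroot) ∈ L) {α : V} (hα : α ∈ R.roots) :
    coroot α ∈ L := by
  obtain ⟨w, hw, hne⟩ := R.exists_inner_weyl_hroot_ne_zero hα
  have hwr : w R.hroot ∈ R.roots := (weyl_mem_roots_iff hw).2 hroot_mem
  have hwL : coroot (w R.hroot) ∈ L := by rw [coroot_weyl hw]; exact hL w hw
  by_cases h1 : α = w R.hroot
  · rw [h1]; exact hwL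
  by_cases h2 : α = -w R.hroot
  · rw [h2, coroot_neg]; exact neg_mem hwL
  have hlt := abs_inner_coroot_lt_two hα hwr
    (by rw [norm_weyl hw]; exact norm_le_norm_hroot hm hα) h1 h2
  have hne' : ⟪α, coroot (w R.hroot)⟫ ≠ 0 := by
    have : ‖w R.hroot‖ ≠ 0 := norm_ne_zero_iff.2 (R.ne_zero _ hwr)
    rw [inner_coroot]
    positivity
  have hrefl : coroot (w R.hroot) - ⟪α, coroot (w R.hroot)⟫ • coroot α ∈ L := by
    have := hL _ (mul_mem (R.reflEquiv_mem_weylGroup hα) hw)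
    rwa [LinearEquiv.mul_apply, reflEquiv_apply, sRefl, ← coroot_weyl hw] at this
  obtain ⟨n, hn⟩ := R.crystallographic _ hwr α hα
  rw [hn] at hlt hne' hrefl
  have hsm : ((n : ℝ) • coroot α) ∈ L := by
    simpa using sub_mem hwL hrefl
  have hn2 : |n| < 2 := by exact_mod_cast hlt
  have hn0 : n ≠ 0 := by exact_mod_cast hne'
  rw [abs_lt] at hn2
  obtain rfl | rfl : n = 1 ∨ n = -1 := by omega
  · simpa using hsm
  · simpa using hsm

/-- The number `2ρ(φ∨)` is even. -/
lemma prod_neg_one_pow_pos {m : V → ℕ}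
    (hm : ∀ α ∈ R.pos, ⟪α, coroot R.hroot⟫ = (m α : ℝ)) :
    ∏ α ∈ R.pos, (-1 : ℂ) ^ m α = 1 := by
  classical
  have hφ0 := R.ne_zero _ R.hroot_mem
  have hform : ∀ α ∈ R.pos, -sRefl R.hroot α = (m α : ℝ) • R.hroot - α := fun α hα => by
    rw [sRefl_eq, hm α hα]; abel
  have hmem : ∀ α ∈ R.pos, m α ≠ 0 → -sRefl R.hroot α ∈ R.pos := by
    intro α hα h0
    obtain ⟨c, hc, hcs⟩ := R.hroot_highest α (R.pos_sub hα)
    obtain ⟨d, hd, hds⟩ := R.pos_combo _ R.hroot_pos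
    have h1 : (1 : ℝ) ≤ m α := by exact_mod_cast Nat.one_le_iff_ne_zero.2 h0
    refine mem_pos_of_combo (neg_mem_roots (R.refl_mem _ hroot_mem α (R.pos_sub hα)))
      (c := fun β => (m α - 1) * d β + c β)
      (fun β => add_nonneg (mul_nonneg (by linarith) (hd β)) (hc β)) ?_
    simp only [add_smul, mul_smul, Finset.sum_add_distrib, ← Finset.smul_sum, ← hds, ← hcs]
    rw [hform α hα]
    module
  have hval : ∀ α ∈ R.pos, m α ≠ 0 → m (-sRefl R.hroot α) = m α := by
    intro α hα h0
    have h := hm _ (hmem α hα h0)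
    rw [hform α hα, inner_sub_left, real_inner_smul_left, inner_coroot_self hφ0, hm α hα,
      ← hform α hα] at h
    have h' : (m (-sRefl R.hroot α) : ℝ) = m α := by linarith
    exact_mod_cast h'
  refine Finset.prod_involution
    (fun α _ => if m α = 0 then α else -sRefl R.hroot α) (fun α hα => ?_) (fun α hα hne => ?_)
    (fun α hα => ?_) (fun α hα => ?_)
  · by_cases h0 : m α = 0
    · simp [h0]
    · simp only [h0, if_false]
      rw [hval α hα h0, ← mul_pow]
      simp
  · by_cases h0 : m α = 0
    · simp [h0] at hne
    · simp only [h0, if_false]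
      intro heq
      rw [hform α hα] at heq
      have hα' : α = ((m α : ℝ) / 2) • R.hroot := by
        have : (2 : ℝ) • α = (m α : ℝ) • R.hroot := by
          rw [two_smul]; nth_rewrite 1 [← heq]; abel
        rw [div_eq_inv_mul, mul_smul, ← this, smul_smul]
        norm_num
      have hpos : (0 : ℝ) ≤ m α := by positivity
      rcases R.reduced _ hroot_mem _ (hα' ▸ R.pos_sub hα) with h | h
      · have h2 : (m α : ℝ) = (2 : ℕ) := by push_cast; linarith
        have h2' : m α = 2 := by exact_mod_cast h2
        rw [h2'] at hne
        norm_num at hne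
      · linarith
  · by_cases h0 : m α = 0
    · simpa [h0] using hα
    · simpa only [h0, if_false] using hmem α hα h0
  · by_cases h0 : m α = 0
    · simp [h0]
    · simp only [h0, if_false, hval α hα h0]
      have hlin : sRefl R.hroot (-sRefl R.hroot α) = -sRefl R.hroot (sRefl R.hroot α) :=
        map_neg (reflEquiv R.hroot hφ0) _
      rw [hlin, sRefl_sRefl hφ0, neg_neg]

end RootSystemBase

section Bethe

/-- The scattering factor expressed through the phase `arctan (x / k)`. -/
lemma sub_div_add_eq_neg_exp_arctan (x : ℝ) {k : ℝ} (hk : 0 < k) :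
    (Complex.I * (x : ℂ) - (k : ℂ)) / (Complex.I * (x : ℂ) + (k : ℂ)) =
      -Complex.exp (-(Complex.I * ((2 * Real.arctan (x / k) : ℝ) : ℂ))) := by
  set θ := Real.arctan (x / k) with hθ
  have hc : 0 < Real.cos θ := Real.cos_arctan_pos _
  have hx : x = k * (Real.sin θ / Real.cos θ) := by
    rw [← Real.tan_eq_sin_div_cos, hθ, Real.tan_arctan]
    field_simp
  have hE : Complex.exp (Complex.I * θ) = Real.cos θ + Real.sin θ * Complex.I := by
    rw [mul_comm, Complex.exp_mul_I, Complex.ofReal_cos, Complex.ofReal_sin]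
  have hE' : Complex.exp (-(Complex.I * θ)) = Real.cos θ - Real.sin θ * Complex.I := by
    rw [mul_comm, ← neg_mul, Complex.exp_mul_I, Complex.cos_neg, Complex.sin_neg,
      Complex.ofReal_cos, Complex.ofReal_sin]
    ring
  have hne : (Real.cos θ + Real.sin θ * Complex.I : ℂ) ≠ 0 := hE ▸ Complex.exp_ne_zero _
  have hexp : Complex.exp (-(Complex.I * ((2 * θ : ℝ) : ℂ))) =
      (Real.cos θ - Real.sin θ * Complex.I) / (Real.cos θ + Real.sin θ * Complex.I) := by
    rw [← hE, ← hE', ← Complex.exp_sub]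
    congr 1
    push_cast
    ring
  have hcC : (Real.cos θ : ℂ) ≠ 0 := by exact_mod_cast hc.ne'
  have hkC : (k : ℂ) ≠ 0 := by exact_mod_cast hk.ne'
  have hden : Complex.I * (x : ℂ) + k =
      k / Real.cos θ * (Real.cos θ + Real.sin θ * Complex.I) := by
    rw [hx, Complex.ofReal_mul, Complex.ofReal_div]
    field_simp
    ring
  have hnum : Complex.I * (x : ℂ) - k =
      -(k / Real.cos θ) * (Real.cos θ - Real.sin θ * Complex.I) := by
    rw [hx, Complex.ofReal_mul, Complex.ofReal_div]
    field_simp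
    ring
  rw [hexp, hden, hnum]
  field_simp

variable {V : Type*} [NormedAddCommGroup V] [InnerProductSpace ℝ V] [FiniteDimensional ℝ V]
  {R : RootSystemBase V} {k : V → ℝ}

lemma inner_sigmaFun_coroot_hroot (hk : IsMultiplicity R k) {m : V → ℕ}
    (hm : ∀ α ∈ R.pos, ⟪α, coroot R.hroot⟫ = (m α : ℝ)) (ξ : V) :
    ⟪sigmaFun R k ξ, coroot R.hroot⟫ =
      ∑ α ∈ R.pos, (m α : ℝ) * (2 * Real.arctan (⟪ξ, coroot α⟫ / k α)) := by
  rw [sigmaFun, sum_inner, RootSystemBase.sum_roots_eq_two_mul_sum_pos, Finset.mul_sum]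
  · refine Finset.sum_congr rfl fun α hα => ?_
    rw [real_inner_smul_left, hm α hα]
    ring
  · intro α hα
    rw [coroot_neg, inner_neg_right, RootSystemBase.multiplicity_neg hk hα, neg_div,
      Real.arctan_neg, neg_smul_neg]

lemma prod_scattering_eq_exp (hk : IsMultiplicity R k) {m : V → ℕ}
    (hm : ∀ α ∈ R.pos, ⟪α, coroot R.hroot⟫ = (m α : ℝ)) (ξ : V) :
    ∏ α ∈ R.pos, ((Complex.I * (⟪ξ, coroot α⟫ : ℝ) - (k α : ℂ)) /
        (Complex.I * (⟪ξ, coroot α⟫ : ℝ) + (k α : ℂ))) ^ (m α) =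
      Complex.exp (-(Complex.I * (⟪sigmaFun R k ξ, coroot R.hroot⟫ : ℝ))) := by
  calc _ = ∏ α ∈ R.pos, ((-1 : ℂ) ^ m α *
        Complex.exp (-(Complex.I *
          ((m α : ℝ) * (2 * Real.arctan (⟪ξ, coroot α⟫ / k α)) : ℝ)))) := by
        refine Finset.prod_congr rfl fun α hα => ?_
        rw [sub_div_add_eq_neg_exp_arctan _ (hk.1 α (R.pos_sub hα)), neg_pow, ← Complex.exp_nat_mul]
        congr 2
        push_cast
        ring
    _ = _ := by
        rw [Finset.prod_mul_distrib, RootSystemBase.prod_neg_one_pow_pos hm, one_mul,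
          ← Complex.exp_sum, inner_sigmaFun_coroot_hroot hk hm]
        congr 1
        rw [Complex.ofReal_sum, Finset.mul_sum, Finset.sum_neg_distrib]

/-- The Bethe equations in logarithmic form. -/
lemma isBetheRoot_iff_forall_weyl (hk : IsMultiplicity R k) {m : V → ℕ}
    (hm : ∀ α ∈ R.pos, ⟪α, coroot R.hroot⟫ = (m α : ℝ)) (η : V) :
    IsBetheRoot R k m η ↔ ∀ w ∈ weylGroup R, ∃ n : ℤ,
      ⟪w (η + sigmaFun R k η), coroot R.hroot⟫ = n * (2 * Real.pi) := by
  refine forall₂_congr fun w hw => ?_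
  rw [prod_scattering_eq_exp hk hm, Complex.exp_eq_exp_iff_exists_int, map_add,
    ← RootSystemBase.sigmaFun_weyl hk hw, inner_add_left]
  refine exists_congr fun n => ?_
  rw [← Complex.ofReal_inj]
  refine Iff.trans ?_ (mul_right_inj' Complex.I_ne_zero)
  push_cast
  constructor <;> intro h <;> linear_combination h

lemma isBetheRoot_iff_exists_weight (hk : IsMultiplicity R k) {m : V → ℕ}
    (hm : ∀ α ∈ R.pos, ⟪α, coroot R.hroot⟫ = (m α : ℝ)) (η : V) :
    IsBetheRoot R k m η ↔
      ∃ μ : V, IsWeight R μ ∧ η + sigmaFun R k η = (2 * Real.pi) • μ := by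
  have hpi : 2 * Real.pi ≠ 0 := by positivity
  rw [isBetheRoot_iff_forall_weyl hk hm]
  constructor
  · intro h
    refine ⟨(2 * Real.pi)⁻¹ • (η + sigmaFun R k η), ?_, (smul_inv_smul₀ hpi _).symm⟩
    let μ := (2 * Real.pi)⁻¹ • (η + sigmaFun R k η)
    let L : AddSubgroup V :=
      (Int.castAddHom ℝ).range.comap (innerSL ℝ μ : V →ₗ[ℝ] ℝ).toAddMonoidHom
    have hL : ∀ x, x ∈ L ↔ ∃ n : ℤ, (n : ℝ) = ⟪μ, x⟫ := fun x => Iff.rfl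
    intro α hα
    have hmem : coroot α ∈ L := by
      refine RootSystemBase.coroot_mem_of_weyl_coroot_hroot_mem hm L (fun w hw => ?_) hα
      obtain ⟨n, hn⟩ := h w⁻¹ (inv_mem hw)
      refine (hL _).2 ⟨n, ?_⟩
      have hw' : w (w⁻¹ (η + sigmaFun R k η)) = η + sigmaFun R k η := w.apply_symm_apply _
      rw [real_inner_smul_left, ← hw', RootSystemBase.inner_weyl hw, hn]
      field_simp
    obtain ⟨n, hn⟩ := (hL _).1 hmem
    exact ⟨n, hn.symm⟩
  · rintro ⟨μ, hμ, h⟩ w hw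
    have hmem : w⁻¹ R.hroot ∈ R.roots :=
      (RootSystemBase.weyl_mem_roots_iff (inv_mem hw)).2 RootSystemBase.hroot_mem
    obtain ⟨n, hn⟩ := hμ _ hmem
    refine ⟨n, ?_⟩
    have hw' : w (w⁻¹ (coroot R.hroot)) = coroot R.hroot := w.apply_symm_apply _
    rw [h, ← hw', RootSystemBase.inner_weyl hw, real_inner_smul_left,
      ← RootSystemBase.coroot_weyl (inv_mem hw), hn]
    ring

lemma hasFDerivAt_masterFun (R : RootSystemBase V) (k : V → ℝ) (μ η : V) :
    HasFDerivAt (masterFun R k μ)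
      (innerSL ℝ (η + sigmaFun R k η - (2 * Real.pi) • μ)) η := by
  have hint : ∀ α ∈ R.roots, HasFDerivAt
      (fun ξ : V => ‖α‖ ^ 2 * ∫ t in (0:ℝ)..(⟪ξ, coroot α⟫), Real.arctan (t / k α))
      (‖α‖ ^ 2 • (Real.arctan (⟪η, coroot α⟫ / k α) • innerSL ℝ (coroot α))) η := by
    intro α _
    have hcont : Continuous fun t : ℝ => Real.arctan (t / k α) := by fun_prop
    have hin : HasFDerivAt (fun ξ : V => ⟪ξ, coroot α⟫) (innerSL ℝ (coroot α)) η := by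
      simpa [real_inner_comm] using (innerSL ℝ (coroot α)).hasFDerivAt (x := η)
    exact ((hcont.integral_hasStrictDerivAt 0 _).hasDerivAt.comp_hasFDerivAt η hin).const_mul _
  have hsq : HasFDerivAt (fun ξ : V => ‖ξ‖ ^ 2 / 2) (innerSL ℝ η) η := by
    simp only [div_eq_mul_inv]
    refine ((hasStrictFDerivAt_norm_sq η).hasFDerivAt.mul_const (2⁻¹ : ℝ)).congr_fderiv ?_
    ext v
    simp
  have hlin : HasFDerivAt (fun ξ : V => 2 * Real.pi * ⟪μ, ξ⟫)
      ((2 * Real.pi) • innerSL ℝ μ) η :=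
    (innerSL ℝ μ).hasFDerivAt.const_mul _
  refine HasFDerivAt.congr_fderiv (f := masterFun R k μ)
    ((hsq.sub hlin).add ((HasFDerivAt.fun_sum hint).const_mul (1 / 2))) ?_
  ext v
  have hsum : ⟪sigmaFun R k η, v⟫ = 1 / 2 * ∑ α ∈ R.roots,
      ‖α‖ ^ 2 * (Real.arctan (⟪η, coroot α⟫ / k α) * ⟪coroot α, v⟫) := by
    rw [sigmaFun, sum_inner, Finset.mul_sum]
    refine Finset.sum_congr rfl fun α hα => ?_
    have : ‖α‖ ≠ 0 := norm_ne_zero_iff.2 (R.ne_zero α hα)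
    rw [real_inner_smul_left, real_inner_comm v (coroot α), inner_coroot v, real_inner_comm α v]
    field_simp
  simp only [innerSL_apply_apply, inner_sub_left, inner_add_left, real_inner_smul_left, hsum,
    add_apply, sub_apply, smul_apply,
    sum_apply, smul_eq_mul]
  ring

lemma fderiv_masterFun_eq_zero_iff (R : RootSystemBase V) (k : V → ℝ) (μ η : V) :
    fderiv ℝ (masterFun R k μ) η = 0 ↔ η + sigmaFun R k η = (2 * Real.pi) • μ := by
  rw [(hasFDerivAt_masterFun R k μ η).fderiv, ← sub_eq_zero (a := η + sigmaFun R k η)]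
  refine ⟨fun h => ?_, fun h => by rw [h, map_zero]⟩
  rw [← inner_self_eq_zero (𝕜 := ℝ), ← innerSL_apply_apply, h]
  rfl

end Bethe

/-- `η ∈ V*` is a Bethe root (`λ = iη` solves the Bethe ansatz equations)
iff `η` is a critical point of `S_k(μ,·)` for some weight `μ ∈ P`, equivalently iff
`η + σ_η^k = 2πμ` for some `μ ∈ P`. -/
theorem statement2
    {V : Type*} [NormedAddCommGroup V] [InnerProductSpace ℝ V] [FiniteDimensional ℝ V]
    (R : RootSystemBase V) (k : V → ℝ) (hk : IsMultiplicity R k)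
    (m : V → ℕ) (hm : ∀ α ∈ R.pos, ⟪α, coroot R.hroot⟫ = (m α : ℝ))
    (η : V) :
    (IsBetheRoot R k m η ↔
      ∃ μ : V, IsWeight R μ ∧ fderiv ℝ (masterFun R k μ) η = 0) ∧
    (IsBetheRoot R k m η ↔
      ∃ μ : V, IsWeight R μ ∧ η + sigmaFun R k η = (2 * Real.pi) • μ) := by
  refine ⟨?_, isBetheRoot_iff_exists_weight hk hm η⟩
  simp only [fderiv_masterFun_eq_zero_iff]
  exact isBetheRoot_iff_exists_weight hk hm η

end
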